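/- arXiv:0803.3781 — 5 statements merged into one kernel-verified Lean document; each statement's English description precedes it below -/
import Mathlib

section
/- Let n = 4k and let s satisfy gcd(s,2k) = 1. Let d, e ∈ L* with L = GF(2^n), suppose d^{2^s−1} is not a cube in L, and let v ∈ L*. Then the set of u ∈ L satisfying e^{2^s} d^{2^{−s}} (u^{2^{−2s}} v + v^{2^{−2s}} u) + e^{2^{−s}} d^{2^{2s}} (u^{2^{2s}} v + v^{2^{2s}} u) = 0 is exactly {w·v : w ∈ GF(4)}, where GF(4) denotes the subfield of L with 4 elements. In particular this equation has exactly 4 solutions. -/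
/-- A power of two with odd exponent is `2` modulo `3`. -/
theorem two_pow_odd_eq {m : ℕ} (hm : Odd m) : ∃ a, 2 ^ m = 3 * a + 2 := by
  obtain ⟨j, rfl⟩ := hm
  refine ⟨2 ^ (2 * j + 1) / 3, ?_⟩
  have h : 2 ^ (2 * j + 1) % 3 = 2 := by
    rw [pow_succ, pow_mul, Nat.mul_mod, Nat.pow_mod]
    norm_num
  have hdiv := Nat.div_add_mod (2 ^ (2 * j + 1)) 3
  rw [h] at hdiv
  exact hdiv.symm

/-- A power of two with even exponent is `1` modulo `3`. -/
theorem two_pow_two_mul_eq (m : ℕ) : ∃ a, 2 ^ (2 * m) = 3 * a + 1 := by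
  refine ⟨2 ^ (2 * m) / 3, ?_⟩
  have h : 2 ^ (2 * m) % 3 = 1 := by
    rw [pow_mul, Nat.pow_mod]
    norm_num
  omega

/-- Iterating `x ↦ x ^ 4` raises to powers of four. -/
theorem iterate_pow_four {M : Type*} [Monoid M] (x : M) (m : ℕ) :
    (fun y : M => y ^ 4)^[m] x = x ^ (2 ^ (2 * m)) := by
  rw [pow_iterate, pow_mul]
  norm_num

/-- If `w` is fixed by the `4 ^ a`- and `4 ^ b`-power maps with `a`, `b` coprime, then
`w ^ 4 = w`. -/
theorem pow_four_eq_self_of_coprime {M : Type*} [Monoid M] {w : M} {a b : ℕ}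
    (hab : Nat.gcd a b = 1) (ha : w ^ (2 ^ (2 * a)) = w) (hb : w ^ (2 ^ (2 * b)) = w) :
    w ^ 4 = w := by
  have h1 : Function.IsPeriodicPt (fun y : M => y ^ 4) a w := by
    rw [Function.IsPeriodicPt, Function.IsFixedPt, iterate_pow_four, ha]
  have h2 : Function.IsPeriodicPt (fun y : M => y ^ 4) b w := by
    rw [Function.IsPeriodicPt, Function.IsFixedPt, iterate_pow_four, hb]
  have h := h1.gcd h2
  rw [hab] at h
  exact h

/-- An element with `w ^ 4 = w` is fixed by every `4 ^ m`-power map. -/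
theorem pow_two_pow_two_mul_eq_self {M : Type*} [Monoid M] {w : M} (hw : w ^ 4 = w) (m : ℕ) :
    w ^ (2 ^ (2 * m)) = w := by
  rw [← iterate_pow_four]
  exact Function.iterate_fixed hw m

/-- A field of characteristic two with a nontrivial cube root of unity has exactly four
solutions of `w ^ 4 = w`. -/
theorem ncard_pow_four_eq_self {L : Type*} [Field L] [CharP L 2] {ω : L} (hω : ω ^ 3 = 1)
    (hω1 : ω ≠ 1) : {w : L | w ^ 4 = w}.ncard = 4 := by
  have h2 : (2 : L) = 0 := CharTwo.two_eq_zero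
  have hq : ω ^ 2 + ω + 1 = 0 := by
    have h : (ω - 1) * (ω ^ 2 + ω + 1) = 0 := by linear_combination hω
    exact (mul_eq_zero.mp h).resolve_left (sub_ne_zero.mpr hω1)
  have hω0 : ω ≠ 0 := by
    rintro rfl
    simp at hq
  have hs : {w : L | w ^ 4 = w} = {0, 1, ω, ω + 1} := by
    ext w
    simp only [Set.mem_ofPred_eq, Set.mem_insert_iff, Set.mem_singleton_iff]
    have hfac : w ^ 4 - w = w * ((w - 1) * ((w - ω) * (w - (ω + 1)))) := by
      linear_combination (w ^ 2 - w) * (1 + w + ω * w) * h2 - (w ^ 2 - w) * hq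
    rw [← sub_eq_zero, hfac, mul_eq_zero, mul_eq_zero, mul_eq_zero, sub_eq_zero, sub_eq_zero,
      sub_eq_zero]
  have h01 : ω + 1 ≠ 0 := fun h => hω1 (by linear_combination h - h2)
  rw [hs, Set.ncard_insert_of_notMem, Set.ncard_insert_of_notMem, Set.ncard_pair]
  · simp
  · simp [hω1.symm, hω0]
  · simp [hω0.symm, h01.symm]

/-- A finite field whose order is a positive power of four contains a nontrivial cube root of
unity. -/
theorem exists_cube_root_of_unity {L : Type*} [Field L] [Fintype L] {m : ℕ}
    (hcard : Fintype.card L = 2 ^ (2 * m)) : ∃ ω : L, ω ^ 3 = 1 ∧ ω ≠ 1 := by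
  classical
  have h3 : 3 ∣ Fintype.card Lˣ := by
    obtain ⟨a, ha⟩ := two_pow_two_mul_eq m
    rw [Fintype.card_units, hcard, ha]
    exact ⟨a, by omega⟩
  have : Fact (Nat.Prime 3) := ⟨Nat.prime_three⟩
  obtain ⟨g, hg⟩ := exists_prime_orderOf_dvd_card 3 h3
  refine ⟨g, ?_, ?_⟩
  · rw [← Units.val_pow_eq_pow_val, ← hg, pow_orderOf_eq_one, Units.val_one]
  · intro h
    rw [Units.val_eq_one] at h
    simp [h] at hg


/-- Let `n = 4k` and let `s` satisfy `gcd(s,2k) = 1`.  Let `d, e ∈ L^*` with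
`L = GF(2^n)`, suppose `d^{2^s-1}` is not a cube in `L`, and let `v ∈ L^*`.  Then
the set of `u ∈ L` satisfying
`e^{2^s} d^{2^{-s}} (u^{2^{-2s}} v + v^{2^{-2s}} u) + e^{2^{-s}} d^{2^{2s}} (u^{2^{2s}} v + v^{2^{2s}} u) = 0`
is exactly `{w·v : w ∈ GF(4)}`, where `GF(4) = {w ∈ L : w⁴ = w}` is the subfield of
`L` with 4 elements.  In particular the equation has exactly 4 solutions.
(A Frobenius index `-j` is rendered by the representative `n - j % n`, which agrees
with it modulo `n`, hence modulo `2^n - 1` on exponents.) -/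
theorem stmt13 (k s : ℕ) (hk : 0 < k) (hgcd : Nat.gcd s (2 * k) = 1)
    (L : Type*) [Field L] [Fintype L] (hcard : Fintype.card L = 2 ^ (4 * k))
    (d e : L) (hd : d ≠ 0) (he : e ≠ 0)
    (hcube : ¬ ∃ x : L, x ^ 3 = d ^ (2 ^ s - 1))
    (v : L) (hv : v ≠ 0) :
    {u : L |
        e ^ (2 ^ s) * d ^ (2 ^ (4 * k - s % (4 * k)))
            * (u ^ (2 ^ (2 * (4 * k - s % (4 * k)))) * v
                + v ^ (2 ^ (2 * (4 * k - s % (4 * k)))) * u)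
          + e ^ (2 ^ (4 * k - s % (4 * k))) * d ^ (2 ^ (2 * s))
            * (u ^ (2 ^ (2 * s)) * v + v ^ (2 ^ (2 * s)) * u) = 0}
      = {u : L | ∃ w : L, w ^ 4 = w ∧ u = w * v} ∧
    {u : L |
        e ^ (2 ^ s) * d ^ (2 ^ (4 * k - s % (4 * k)))
            * (u ^ (2 ^ (2 * (4 * k - s % (4 * k)))) * v
                + v ^ (2 ^ (2 * (4 * k - s % (4 * k)))) * u)
          + e ^ (2 ^ (4 * k - s % (4 * k))) * d ^ (2 ^ (2 * s))
            * (u ^ (2 ^ (2 * s)) * v + v ^ (2 ^ (2 * s)) * u) = 0}.ncard = 4 := by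
  obtain ⟨ω, hω, hω1⟩ := exists_cube_root_of_unity (m := 2 * k) (by rw [hcard]; congr 1; ring)
  have : Fact (Nat.Prime 2) := ⟨Nat.prime_two⟩
  have : CharP L 2 := charP_of_card_eq_prime_pow hcard
  have h2 : (2 : L) = 0 := CharTwo.two_eq_zero
  have hs : Odd s := by
    rw [← Nat.not_even_iff_odd]
    intro h
    have := Nat.dvd_gcd h.two_dvd (Dvd.intro k rfl)
    omega
  have hlt : s % (4 * k) < 4 * k := Nat.mod_lt _ (by omega)
  have hdiv := Nat.div_add_mod s (4 * k)
  set t := 4 * k - s % (4 * k) with ht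
  have hst : t + s = 4 * k * (s / (4 * k) + 1) := by
    rw [mul_add]
    omega
  have htodd : Odd t := by
    rw [← Nat.not_even_iff_odd]
    intro h
    have h' : Even (t + s) := by
      rw [hst, mul_assoc]
      exact Even.mul_right (by decide) _
    exact (Nat.not_even_iff_odd.mpr hs) ((Nat.even_add.mp h').mp h)
  have hfix : ∀ (x : L) (m : ℕ), x ^ (2 ^ (4 * k * m)) = x := fun x m => by
    rw [pow_mul, ← hcard, FiniteField.pow_card_pow]
  have hinv : ∀ x : L, (x ^ (2 ^ (2 * t))) ^ (2 ^ (2 * s)) = x := fun x => by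
    rw [← pow_mul, ← pow_add, ← mul_add, hst,
      show 2 * (4 * k * (s / (4 * k) + 1)) = 4 * k * (2 * (s / (4 * k) + 1)) by ring, hfix]
  have hset : {u : L |
        e ^ (2 ^ s) * d ^ (2 ^ t)
            * (u ^ (2 ^ (2 * t)) * v + v ^ (2 ^ (2 * t)) * u)
          + e ^ (2 ^ t) * d ^ (2 ^ (2 * s))
            * (u ^ (2 ^ (2 * s)) * v + v ^ (2 ^ (2 * s)) * u) = 0}
      = {u : L | ∃ w : L, w ^ 4 = w ∧ u = w * v} := by
    ext u
    simp only [Set.mem_ofPred_eq]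
    constructor
    · intro h
      obtain ⟨w, rfl⟩ : ∃ w, u = w * v := ⟨u / v, by field_simp⟩
      refine ⟨w, ?_, rfl⟩
      obtain ⟨z, hz⟩ : ∃ z, z = w ^ (2 ^ (2 * t)) + w := ⟨_, rfl⟩
      have hzs : z ^ (2 ^ (2 * s)) = w ^ (2 ^ (2 * s)) + w := by
        rw [hz, add_pow_char_pow, hinv, add_comm]
      by_cases hz0 : z = 0
      · have hws : w ^ (2 ^ (2 * s)) = w := by
          rw [hz0, zero_pow (by positivity)] at hzs
          linear_combination -hzs - w * h2
        refine pow_four_eq_self_of_coprime hgcd hws ?_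
        have := hfix w 1
        rwa [show 4 * k * 1 = 2 * (2 * k) by ring] at this
      · exfalso
        obtain ⟨a, ha⟩ := two_pow_odd_eq hs
        obtain ⟨b, hb⟩ := two_pow_odd_eq htodd
        obtain ⟨c, hc⟩ := two_pow_two_mul_eq s
        obtain ⟨f, hf⟩ := two_pow_two_mul_eq t
        rw [mul_pow, mul_pow] at h
        have h' : e ^ (2 ^ s) * d ^ (2 ^ t) * (v ^ (2 ^ (2 * t)) * v * z)
            + e ^ (2 ^ t) * d ^ (2 ^ (2 * s)) * (v ^ (2 ^ (2 * s)) * v * z ^ (2 ^ (2 * s)))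
            = 0 := by
          rw [hzs, hz]
          linear_combination h
        rw [ha, hb, hc, hf] at h'
        have h'' : d * (e ^ a * d ^ b * v ^ f) ^ 3 = (e ^ b * d ^ c * v ^ c * z ^ c) ^ 3 := by
          have hne : d * e ^ 2 * v ^ 2 * z ≠ 0 := by positivity
          apply mul_left_cancel₀ hne
          rw [← sub_eq_zero, CharTwo.sub_eq_add, ← h']
          ring
        refine hcube ⟨((e ^ b * d ^ c * v ^ c * z ^ c) / (e ^ a * d ^ b * v ^ f)) ^ (2 ^ s - 1),
          ?_⟩
        rw [pow_right_comm, div_pow, ← h'', mul_div_cancel_right₀]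
        positivity
    · rintro ⟨w, hw, rfl⟩
      rw [mul_pow, mul_pow, pow_two_pow_two_mul_eq_self hw, pow_two_pow_two_mul_eq_self hw]
      linear_combination (e ^ (2 ^ s) * d ^ (2 ^ t) * w * v ^ (2 ^ (2 * t)) * v
        + e ^ (2 ^ t) * d ^ (2 ^ (2 * s)) * w * v ^ (2 ^ (2 * s)) * v) * h2
  refine ⟨hset, ?_⟩
  have himg : {u : L | ∃ w : L, w ^ 4 = w ∧ u = w * v} = (· * v) '' {w : L | w ^ 4 = w} := by
    ext u
    simp [eq_comm]
  rw [hset, himg, Set.ncard_image_of_injective _ (mul_left_injective₀ hv),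
    ncard_pow_four_eq_self hω hω1]
end

section
/- Let n = 4k with k ≥ 3 odd, and let s satisfy gcd(s,2k) = 1 and sk ≡ −1 (mod 4) (equivalently, 4 divides k + s). Let t be a primitive element of L = GF(2^n) and α = t^{2^k−1}. Then for every b ∈ L*, the element e = b^{2^{2k−s}+2^{k}} α^{2^{k}} + b^{2^{2k}+2^{−k−s}} α^{2^{−k−s}} is nonzero. -/
theorem two_pow_mod_five (m : ℕ) : 2 ^ m % 5 = 2 ^ (m % 4) % 5 := by
  conv_lhs => rw [← Nat.div_add_mod m 4, pow_add, pow_mul, Nat.mul_mod, Nat.pow_mod]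
  simp

theorem five_dvd_two_pow_four_mul_sub_one (k : ℕ) : 5 ∣ 2 ^ (4 * k) - 1 := by
  have h := two_pow_mod_five (4 * k)
  have hpos : 1 ≤ 2 ^ (4 * k) := Nat.one_le_two_pow
  simp at h
  omega

/-- An element whose powers exhaust the units of a finite field has order divisible by every
prime divisor of the number of units. -/
theorem dvd_orderOf_of_forall_eq_pow {L : Type*} [Field L] [Fintype L] {p : ℕ} [Fact p.Prime]
    (hp : p ∣ Fintype.card L - 1) (u : Lˣ) (hu : ∀ y : L, y ≠ 0 → ∃ j : ℕ, y = (u : L) ^ j) :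
    p ∣ orderOf u := by
  classical
  obtain ⟨y, hy⟩ := exists_prime_orderOf_dvd_card (G := Lˣ) p (by rwa [Fintype.card_units])
  obtain ⟨j, hj⟩ := hu y y.ne_zero
  have hyj : y = u ^ j := Units.ext (by simpa using hj)
  rw [← hy, hyj]
  exact orderOf_pow_dvd j


/-- Let `n = 4k` with `k ≥ 3` odd, and let `s` satisfy `gcd(s,2k) = 1` and
`sk ≡ -1 (mod 4)` (equivalently, `4` divides `k + s`).  Let `t` be a primitive
element of `L = GF(2^n)` and `α = t^{2^k-1}`.  Then for every `b ∈ L^*`, the element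
`e = b^{2^{2k-s}+2^k} α^{2^k} + b^{2^{2k}+2^{-k-s}} α^{2^{-k-s}}` is nonzero.
(A Frobenius index `-j` is rendered by the representative `n - j % n`, which agrees
with it modulo `n`, hence modulo `2^n - 1` on exponents.) -/
theorem stmt14 (k s : ℕ) (hk : 3 ≤ k) (hkodd : Odd k)
    (hgcd : Nat.gcd s (2 * k) = 1) (hsk : (s * k) % 4 = 3)
    (L : Type*) [Field L] [Fintype L] (hcard : Fintype.card L = 2 ^ (4 * k))
    (t : L) (ht : ∀ y : L, y ≠ 0 → ∃ j : ℕ, y = t ^ j)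
    (α : L) (hα : α = t ^ (2 ^ k - 1))
    (b : L) (hb : b ≠ 0) :
    b ^ (2 ^ (2 * k + (4 * k - s % (4 * k))) + 2 ^ k) * α ^ (2 ^ k)
      + b ^ (2 ^ (2 * k) + 2 ^ (3 * k + (4 * k - s % (4 * k))))
        * α ^ (2 ^ (3 * k + (4 * k - s % (4 * k)))) ≠ 0 := by
  have hcard' : 5 ∣ Fintype.card L - 1 := hcard ▸ five_dvd_two_pow_four_mul_sub_one k
  have htwo : (2 : L) = 0 := by
    have h := FiniteField.cast_card_eq_zero L
    rw [hcard] at h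
    push_cast at h
    exact eq_zero_of_pow_eq_zero h
  have ht0 : t ≠ 0 := by
    rintro rfl
    have hlt : 2 < Fintype.card L := by
      rw [hcard]
      calc 2 = 2 ^ 1 := rfl
        _ < 2 ^ (4 * k) := Nat.pow_lt_pow_right (by norm_num) (by omega)
    classical
    obtain ⟨y, hy⟩ : ∃ y : L, y ∉ ({0, 1} : Finset L) := by
      by_contra! h
      have := Finset.card_le_card (fun y _ => h y : (Finset.univ : Finset L) ⊆ {0, 1})
      rw [Finset.card_univ] at this
      exact absurd (this.trans Finset.card_le_two) (by omega)
    simp only [Finset.mem_insert, Finset.mem_singleton, not_or] at hy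
    obtain ⟨j, hj⟩ := ht y hy.1
    rcases j.eq_zero_or_pos with rfl | h
    · exact hy.2 (by simpa using hj)
    · exact hy.1 (by rw [hj, zero_pow h.ne'])
  have : Fact (Nat.Prime 5) := ⟨by norm_num⟩
  have hord := dvd_orderOf_of_forall_eq_pow hcard' (Units.mk0 t ht0) ht
  obtain ⟨j, rfl⟩ := ht b hb
  subst hα
  intro he
  have hmod4 : (s % (4 * k)) % 4 = s % 4 := Nat.mod_mod_of_dvd s (dvd_mul_right 4 k)
  have hlt : s % (4 * k) < 4 * k := Nat.mod_lt _ (by omega)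
  generalize s % (4 * k) = r at *
  generalize hA : 2 ^ (2 * k + (4 * k - r)) + 2 ^ k = A at he
  generalize hB : 2 ^ (2 * k) = B at he
  generalize hC : 2 ^ (3 * k + (4 * k - r)) = C at he
  have heq : Units.mk0 t ht0 ^ (j * A + (2 ^ k - 1) * 2 ^ k)
      = Units.mk0 t ht0 ^ (j * (B + C) + (2 ^ k - 1) * C) := by
    ext
    simp only [Units.val_pow_eq_pow_val, Units.val_mk0]
    simp only [pow_add, pow_mul] at he ⊢
    linear_combination he - ((t ^ j) ^ B * (t ^ j) ^ C * (t ^ (2 ^ k - 1)) ^ C) * htwo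
  have hmod := (pow_eq_pow_iff_modEq.mp heq).of_dvd hord
  have hcases : (k % 4 = 1 ∧ s % 4 = 3) ∨ (k % 4 = 3 ∧ s % 4 = 1) := by
    have hs : s % 4 < 4 := Nat.mod_lt _ (by norm_num)
    have hk' : k % 4 < 4 := Nat.mod_lt _ (by norm_num)
    rw [Nat.mul_mod] at hsk
    generalize s % 4 = x at *
    generalize k % 4 = y at *
    interval_cases x <;> interval_cases y <;> simp_all
  have h1 := two_pow_mod_five (2 * k + (4 * k - r))
  have h2 := two_pow_mod_five k
  have h3 := two_pow_mod_five (2 * k)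
  have h4 := two_pow_mod_five (3 * k + (4 * k - r))
  have hpos : 1 ≤ 2 ^ k := Nat.one_le_two_pow
  rw [show (2 * k) % 4 = 2 by omega] at h3
  rw [show (3 * k + (4 * k - r)) % 4 = 0 by omega] at h4
  have hAmod : A % 5 = 0 := by
    rcases hcases with ⟨hk4, hs4⟩ | ⟨hk4, hs4⟩
    · rw [show (2 * k + (4 * k - r)) % 4 = 3 by omega] at h1
      rw [hk4] at h2
      omega
    · rw [show (2 * k + (4 * k - r)) % 4 = 1 by omega] at h1
      rw [hk4] at h2
      omega
  have hBmod : (B + C) % 5 = 0 := by omega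
  have hCmod : C % 5 = 1 := by omega
  rw [Nat.ModEq, Nat.add_mod, Nat.mul_mod, hAmod, Nat.add_mod (j * _), Nat.mul_mod j, hBmod,
    Nat.mul_mod _ (2 ^ k), Nat.mul_mod _ C, hCmod] at hmod
  rcases hcases with ⟨hk4, -⟩ | ⟨hk4, -⟩
  · rw [hk4] at h2
    rw [show (2 ^ k - 1) % 5 = 1 by omega, show 2 ^ k % 5 = 2 by omega] at hmod
    simp at hmod
  · rw [hk4] at h2
    rw [show (2 ^ k - 1) % 5 = 2 by omega, show 2 ^ k % 5 = 3 by omega] at hmod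
    simp at hmod
end

section
/- Let n = 4k with k ≥ 3 odd, and let s satisfy gcd(s,2k) = 1 and sk ≡ −1 (mod 4). Let t be a primitive element of L = GF(2^n) and α = t^{2^k−1}. Let b ∈ L* be such that d = b^{2^{2k−s}+2^{−s}} + (bα)^{2^{k−s}+2^{−k−s}} = 0. Then the equation L_b(u) = b u^{2^s} + (b u)^{2^{−s}} + (bα)^{2^{k}} u^{2^{2k+s}} + (bα)^{2^{−k−s}} u^{2^{2k−s}} = 0 has at most 4 solutions u ∈ L. -/
/-- Let `σ`, `τ` be commuting endomorphisms of a field with `τ⁴ = 1`, and let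
`b · τ²b = τc · τ³c`, so that the system formed by the equation below and its image under `τ²`
is degenerate.  Then the equation has no nonzero solution unless `σb · τc = b · σ(τ³c)`. -/
theorem eq_zero_of_degenerate {L : Type*} [Field L] [CharP L 2] (σ τ : L →+* L)
    (hcomm : ∀ x, τ (σ x) = σ (τ x)) (hτ : ∀ x, τ (τ (τ (τ x))) = x)
    {b c u : L} (hb : b ≠ 0)
    (hdet : b * τ (τ b) = τ c * τ (τ (τ c)))
    (hne : σ b * τ c ≠ b * σ (τ (τ (τ c))))
    (hu : σ b * σ (σ u) + b * u + σ (τ c) * σ (σ (τ (τ u))) + τ (τ (τ c)) * τ (τ u) = 0) :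
    u = 0 := by
  have hdetσ : σ b * σ (τ (τ b)) = σ (τ c) * σ (τ (τ (τ c))) := by
    rw [← map_mul, hdet, map_mul]
  have hσb : σ b ≠ 0 := by simpa using hb
  have hPQ : b * u + τ (τ (τ c)) * τ (τ u) = σ b * σ (σ u) + σ (τ c) * σ (σ (τ (τ u))) := by
    rw [← CharTwo.add_eq_zero]
    linear_combination hu
  have hPQτ := congrArg (fun x => τ (τ x)) hPQ
  simp only [map_add, map_mul, hcomm, hτ] at hPQτ
  have hP : b * u + τ (τ (τ c)) * τ (τ u) = 0 := by
    refine (mul_eq_zero.mp ?_).resolve_left (sub_ne_zero.mpr hne)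
    linear_combination (b * σ b) * hPQτ - (b * σ (τ (τ (τ c)))) * hPQ
      - σ b * τ (τ u) * hdet + b * σ (σ (τ (τ u))) * hdetσ
  have hQ : σ (b * σ u) = σ (τ c * σ (τ (τ u))) := by
    rw [hP] at hPQ
    simpa only [map_mul] using CharTwo.add_eq_zero.mp hPQ.symm
  have hQ' := σ.injective hQ
  have hPσ := congrArg σ (CharTwo.add_eq_zero.mp hP)
  simp only [map_mul] at hPσ
  by_contra hu0
  refine hne ?_
  have hσu : σ u ≠ 0 := by simpa using hu0
  have hστu : σ (τ (τ u)) ≠ 0 := by simpa using hu0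
  apply mul_right_cancel₀ (mul_ne_zero hσu hστu)
  linear_combination (τ c * σ (τ (τ u))) * hPσ - σ (τ (τ (τ c))) * σ (τ (τ u)) * hQ'

/-- In the multiplicative group of `GF(2^(4k))`, the two sides differ modulo fifth powers. -/
theorem frobenius_ratio_ne {L : Type*} [Field L] [Fintype L] {k s : ℕ}
    (hsk : (s * k) % 4 = 3) (hcard : Fintype.card L = 2 ^ (4 * k))
    {t : L} (ht : ∀ y : L, y ≠ 0 → ∃ j : ℕ, y = t ^ j) {b : L} (hb : b ≠ 0) :
    b ^ 2 ^ s * (b * t ^ (2 ^ k - 1)) ^ 2 ^ k ≠ b * (b * t ^ (2 ^ k - 1)) ^ 2 ^ (3 * k + s) := by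
  have two_pow_mod (q r : ℕ) : 2 ^ (4 * q + r) % 5 = 2 ^ r % 5 := by
    rw [pow_add, pow_mul, Nat.mul_mod, Nat.pow_mod]
    simp
  have hkpos : 0 < k := Nat.pos_of_ne_zero (by rintro rfl; simp at hsk)
  have hcard_gt : 1 < Fintype.card L := by
    rw [hcard]; exact Nat.one_lt_two_pow (by omega)
  obtain ⟨E, hE⟩ : ∃ E, Fintype.card L - 1 = 5 * E := by
    have := two_pow_mod k 0
    rw [hcard]
    exact ⟨(2 ^ (4 * k) - 1) / 5, by simp at this; omega⟩
  have hEpos : 0 < E := by omega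
  have ht0 : t ≠ 0 := by
    rintro rfl
    have hsub : ∀ y : L, y ≠ 0 → y = 1 := fun y hy => by
      obtain ⟨j, hj⟩ := ht y hy
      rcases Nat.eq_zero_or_pos j with rfl | hj0
      · simpa using hj
      · rw [zero_pow hj0.ne'] at hj; exact absurd hj hy
    have hle : Fintype.card L ≤ 2 := by
      classical
      rw [← Finset.card_univ]
      refine (Finset.card_le_card (t := {0, 1}) fun y _ => ?_).trans Finset.card_le_two
      by_cases hy : y = 0
      · simp [hy]
      · simp [hsub y hy]
    omega
  have horder : orderOf t = 5 * E := by
    have hgen : ∀ x : Lˣ, x ∈ Subgroup.zpowers (Units.mk0 t ht0) := fun x => by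
      obtain ⟨j, hj⟩ := ht x x.ne_zero
      exact ⟨j, Units.ext (by simp [hj])⟩
    have := orderOf_eq_card_of_forall_mem_zpowers hgen
    rw [Nat.card_units, Nat.card_eq_fintype_card, hE, ← orderOf_units] at this
    simpa using this
  set β := b ^ E with hβ
  set ω := (t ^ (2 ^ k - 1)) ^ E with hω
  have hfive (x : L) (hx : x ≠ 0) : (x ^ E) ^ 5 = 1 := by
    rw [← pow_mul, mul_comm, ← hE, FiniteField.pow_card_sub_one_eq_one x hx]
  have hβ5 : β ^ 5 = 1 := hfive b hb
  have hω5 : ω ^ 5 = 1 := hfive _ (pow_ne_zero _ ht0)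
  have hβω5 : (β * ω) ^ 5 = 1 := by rw [mul_pow, hβ5, hω5, mul_one]
  have hω1 (hk5 : (2 ^ k - 1) % 5 ≠ 0) : ω ≠ 1 := by
    intro h
    rw [hω, ← pow_mul] at h
    have hdvd := orderOf_dvd_of_pow_eq_one h
    rw [horder] at hdvd
    exact hk5 (Nat.mod_eq_zero_of_dvd (Nat.dvd_of_mul_dvd_mul_right hEpos hdvd))
  intro h
  have hE' : β ^ 2 ^ s * (β * ω) ^ 2 ^ k = β * (β * ω) ^ 2 ^ (3 * k + s) := by
    have := congrArg (· ^ E) h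
    simp only [mul_pow, ← pow_mul, hβ, hω] at this ⊢
    simpa only [mul_assoc, mul_comm, mul_left_comm] using this
  rw [pow_eq_pow_mod _ hβ5, pow_eq_pow_mod (2 ^ k) hβω5,
    pow_eq_pow_mod (2 ^ (3 * k + s)) hβω5] at hE'
  have hβ0 : β ≠ 0 := pow_ne_zero _ hb
  have hω0 : ω ≠ 0 := pow_ne_zero _ (pow_ne_zero _ ht0)
  have hmod : (k % 4 = 1 ∧ s % 4 = 3) ∨ (k % 4 = 3 ∧ s % 4 = 1) := by
    rw [Nat.mul_mod] at hsk
    have := Nat.mod_lt k (show 0 < 4 by norm_num)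
    have := Nat.mod_lt s (show 0 < 4 by norm_num)
    interval_cases k % 4 <;> interval_cases s % 4 <;> simp_all
  rcases hmod with ⟨hk4, hs4⟩ | ⟨hk4, hs4⟩
  · have hk' := two_pow_mod (k / 4) 1
    have hs' := two_pow_mod (s / 4) 3
    have hks' := two_pow_mod ((3 * k + s) / 4) 2
    rw [show 4 * (k / 4) + 1 = k by omega] at hk'
    rw [show 4 * (s / 4) + 3 = s by omega] at hs'
    rw [show 4 * ((3 * k + s) / 4) + 2 = 3 * k + s by omega] at hks'
    norm_num at hk' hs' hks'
    rw [hk', hs', hks'] at hE'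
    have hsq : ω ^ 2 = 1 := by
      refine mul_left_cancel₀ (mul_ne_zero (pow_ne_zero 5 hβ0) (pow_ne_zero 2 hω0)) ?_
      linear_combination -hE'
    refine hω1 (by have := Nat.one_le_two_pow (n := k); omega) ?_
    linear_combination hω5 - ω * (ω ^ 2 + 1) * hsq
  · have hk' := two_pow_mod (k / 4) 3
    have hs' := two_pow_mod (s / 4) 1
    have hks' := two_pow_mod ((3 * k + s) / 4) 2
    rw [show 4 * (k / 4) + 3 = k by omega] at hk'
    rw [show 4 * (s / 4) + 1 = s by omega] at hs'
    rw [show 4 * ((3 * k + s) / 4) + 2 = 3 * k + s by omega] at hks'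
    norm_num at hk' hs' hks'
    rw [hk', hs', hks'] at hE'
    refine hω1 (by have := Nat.one_le_two_pow (n := k); omega) ?_
    refine mul_left_cancel₀ (mul_ne_zero (pow_ne_zero 5 hβ0) (pow_ne_zero 3 hω0)) ?_
    linear_combination -hE'


/-- Let `n = 4k` with `k ≥ 3` odd, and let `s` satisfy `gcd(s,2k) = 1` and
`sk ≡ -1 (mod 4)`.  Let `t` be a primitive element of `L = GF(2^n)` and
`α = t^{2^k-1}`.  Let `b ∈ L^*` be such that
`d = b^{2^{2k-s}+2^{-s}} + (bα)^{2^{k-s}+2^{-k-s}} = 0`.  Then the equation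
`L_b(u) = b u^{2^s} + (bu)^{2^{-s}} + (bα)^{2^k} u^{2^{2k+s}} + (bα)^{2^{-k-s}} u^{2^{2k-s}} = 0`
has at most 4 solutions `u ∈ L`.
(A Frobenius index `-j` is rendered by the representative `n - j % n`, which agrees
with it modulo `n`, hence modulo `2^n - 1` on exponents.) -/
theorem stmt16 (k s : ℕ) (hk : 3 ≤ k) (hkodd : Odd k)
    (hgcd : Nat.gcd s (2 * k) = 1) (hsk : (s * k) % 4 = 3)
    (L : Type*) [Field L] [Fintype L] (hcard : Fintype.card L = 2 ^ (4 * k))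
    (t : L) (ht : ∀ y : L, y ≠ 0 → ∃ j : ℕ, y = t ^ j)
    (α : L) (hα : α = t ^ (2 ^ k - 1))
    (b : L) (hb : b ≠ 0)
    (hd : b ^ (2 ^ (2 * k + (4 * k - s % (4 * k))) + 2 ^ (4 * k - s % (4 * k)))
        + (b * α) ^ (2 ^ (k + (4 * k - s % (4 * k)))
            + 2 ^ (3 * k + (4 * k - s % (4 * k)))) = 0) :
    {u : L |
        b * u ^ (2 ^ s) + (b * u) ^ (2 ^ (4 * k - s % (4 * k)))
          + (b * α) ^ (2 ^ k) * u ^ (2 ^ (2 * k + s))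
          + (b * α) ^ (2 ^ (3 * k + (4 * k - s % (4 * k))))
            * u ^ (2 ^ (2 * k + (4 * k - s % (4 * k)))) = 0}.ncard ≤ 4 := by
  have : CharP L 2 := charP_of_card_eq_prime_pow hcard
  set r := 4 * k - s % (4 * k) with hr
  have hrs : ∃ q, r + s = 4 * k * q := by
    have := Nat.mod_lt s (show 0 < 4 * k by omega)
    have := Nat.div_add_mod s (4 * k)
    exact ⟨s / (4 * k) + 1, by rw [mul_add]; omega⟩
  have hperiod (q : ℕ) (x : L) : x ^ 2 ^ (4 * k * q) = x := by
    rw [pow_mul, ← hcard, FiniteField.pow_card_pow]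
  have hρσ (x : L) : x ^ 2 ^ (r + s) = x := by
    obtain ⟨q, hq⟩ := hrs
    rw [hq, hperiod]
  have hρσ_add (x : L) (i : ℕ) : x ^ 2 ^ (i + r + s) = x ^ 2 ^ i := by
    rw [add_assoc, pow_add 2 i, pow_mul, hρσ]
  let σ := iterateFrobenius L 2 s
  let τ := iterateFrobenius L 2 k
  have hσ (x : L) : σ x = x ^ 2 ^ s := rfl
  have hτ (x : L) : τ x = x ^ 2 ^ k := rfl
  have hdet : b * τ (τ b) = τ (b * α) * τ (τ (τ (b * α))) := by
    have h := congrArg σ (CharTwo.add_eq_zero.mp hd)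
    simp only [hσ, hτ, ← pow_mul, ← pow_add, add_mul] at h ⊢
    simp only [pow_add (_ : L), hρσ_add, hρσ] at h
    rw [mul_comm, ← two_mul, h, show 2 * k + k = 3 * k by ring, pow_add (b * α)]
  have hne : σ b * τ (b * α) ≠ b * σ (τ (τ (τ (b * α)))) := by
    have h := frobenius_ratio_ne hsk hcard ht hb
    rw [← hα] at h
    simp only [hσ, hτ, ← pow_mul, ← pow_add]
    rwa [show k + k + k + s = 3 * k + s by ring]
  refine (Set.ncard_le_ncard (t := {0}) (fun u hu => ?_)).trans (by simp)
  refine eq_zero_of_degenerate σ τ (fun x => ?_) (fun x => ?_) hb hdet hne ?_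
  · simp only [hσ, hτ, ← pow_mul, mul_comm]
  · simp only [hτ, ← pow_mul, ← pow_add]
    simpa [show k + k + k + k = 4 * k by ring] using hperiod 1 x
  · have h := congrArg σ hu
    simp only [map_add, map_zero, map_mul (σ)] at h
    simp only [hσ, hτ, ← pow_mul, ← pow_add] at h ⊢
    rw [hρσ, hρσ_add, hρσ_add] at h
    rw [← h]
    ring_nf
end

section
/- Let f be the binomial of Family (1) on L = GF(2^{3k}) with k odd (so that n = 3k is odd). Then f is almost perfect nonlinear (APN): for every a ∈ L* and b ∈ L, the equation f(x + a) + f(x) = b has at most 2 solutions x ∈ L. -/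
/-- A twisted-linear equation attached to two commuting endomorphisms `σ`, `τ` with `τ ^ 3 = 1`:
either `y` or `w` is fixed by `τ`, or `w` has the shape `σ d / (l * τ d)` with `l` fixed by `τ`. -/
lemma fixed_or_exists_twisted_quotient {L : Type*} [Field L] (σ τ : L →+* L)
    (hcomm : ∀ x, τ (σ x) = σ (τ x)) (hτ : ∀ x, τ (τ (τ x)) = x) (w y : L) (hw : w ≠ 0)
    (h : w * (σ y - y) = τ (τ w) * (σ (τ (τ y)) - τ y)) :
    τ y = y ∨ τ w = w ∨ ∃ d l : L, d ≠ 0 ∧ l ≠ 0 ∧ τ l = l ∧ σ d = l * w * τ d := by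
  by_cases hy : τ y = y
  · exact Or.inl hy
  by_cases hd : τ w = w
  · exact Or.inr (Or.inl hd)
  refine Or.inr (Or.inr ?_)
  have h1 := congrArg τ h
  have h2 := congrArg τ h1
  simp only [map_mul, map_sub, hcomm, hτ] at h1 h2
  have hS : (w - τ w) * (y - τ (τ y)) + (τ w - τ (τ w)) * (τ y - τ (τ y)) = 0 := by
    linear_combination -h - h1 - h2
  have hσS := congrArg σ hS
  simp only [map_mul, map_sub, map_add, map_zero] at hσS
  have hE : w * (τ w - τ (τ w)) * (σ y - σ (τ (τ y)))
      + τ w * (τ (τ w) - w) * (σ (τ y) - σ (τ (τ y))) = 0 := by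
    linear_combination τ w * h + τ (τ w) * h1 + w * h2
  have hQ : σ (τ y) - σ (τ (τ y)) ≠ 0 := fun hq =>
    hy (τ.injective (σ.injective (sub_eq_zero.mp hq))).symm
  have hd0 : w - τ w ≠ 0 := fun h0 => hd (sub_eq_zero.mp h0).symm
  have hτd : τ w - τ (τ w) ≠ 0 := by
    rw [← map_sub]; exact (map_ne_zero τ).mpr hd0
  have hτd2 : τ (τ w) - w ≠ 0 := by
    have := (map_ne_zero τ).mpr hτd
    rwa [map_sub, hτ] at this
  have hτw : τ w ≠ 0 := (map_ne_zero τ).mpr hw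
  have hcross : (σ w - σ (τ w)) * (τ w * (τ (τ w) - w))
      = (σ (τ w) - σ (τ (τ w))) * (w * (τ w - τ (τ w))) := by
    refine mul_right_cancel₀ hQ ?_
    linear_combination (σ w - σ (τ w)) * hE - w * (τ w - τ (τ w)) * hσS
  refine ⟨w - τ w, (σ w - σ (τ w)) / (w * (τ w - τ (τ w))), hd0, ?_, ?_, ?_⟩
  · refine div_ne_zero ?_ (mul_ne_zero hw hτd)
    rw [← map_sub]; exact (map_ne_zero σ).mpr hd0
  · simp only [map_div₀, map_mul, map_sub, hcomm, hτ]
    rw [div_eq_div_iff (mul_ne_zero hτw hτd2) (mul_ne_zero hw hτd)]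
    exact hcross.symm
  · simp only [map_sub]
    field_simp

lemma two_pow_mod_seven (n : ℕ) : 2 ^ n % 7 = 2 ^ (n % 3) % 7 := by
  conv_lhs => rw [← Nat.div_add_mod n 3, pow_add, pow_mul, Nat.mul_mod, Nat.pow_mod]
  norm_num

/-- If `7` divides the order of the group of units of a finite field, a generator of that group
is not a seventh power. -/
lemma generator_not_seventh_power {L : Type*} [Field L] [Fintype L]
    (hdvd : 7 ∣ Fintype.card L - 1) (t : L) (ht : ∀ y : L, y ≠ 0 → ∃ j : ℕ, y = t ^ j)
    (z : L) : t ≠ z ^ 7 := by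
  classical
  intro htz
  have hsurj : Function.Surjective (fun u : Lˣ => u ^ 7) := by
    intro u
    obtain ⟨j, hj⟩ := ht u u.ne_zero
    have hzj : z ^ j ≠ 0 := by
      intro h0
      apply u.ne_zero
      rw [hj, htz, ← pow_mul, mul_comm, pow_mul, h0, zero_pow (by norm_num)]
    refine ⟨Units.mk0 _ hzj, Units.ext ?_⟩
    simp only [Units.val_pow_eq_pow_val, Units.val_mk0]
    rw [hj, htz, ← pow_mul, ← pow_mul, mul_comm]
  have hinj := Finite.injective_iff_surjective.mpr hsurj
  have : Fact (Nat.Prime 7) := ⟨by norm_num⟩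
  obtain ⟨g, hg⟩ := exists_prime_orderOf_dvd_card (G := Lˣ) 7
    (by rwa [Fintype.card_units])
  have hg1 : g = 1 := hinj (by simp only [one_pow]; rw [← hg, pow_orderOf_eq_one])
  rw [hg1, orderOf_one] at hg
  norm_num at hg

/-- A nonzero element fixed by `x ↦ x ^ 2 ^ r`, with `3 ∤ r`, is a seventh power. -/
lemma seventh_power_of_pow_two_pow_eq_self {L : Type*} [Field L] {r : ℕ} (hr : r % 3 ≠ 0) {l : L}
    (hl : l ≠ 0) (h : l ^ 2 ^ r = l) : ∃ z : L, l = z ^ 7 := by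
  have hord : orderOf l ∣ 2 ^ r - 1 := by
    apply orderOf_dvd_of_pow_eq_one
    refine mul_right_cancel₀ hl ?_
    rw [← pow_succ, Nat.sub_add_cancel Nat.one_le_two_pow, h, one_mul]
  have hcop : Nat.Coprime (orderOf l) 7 := by
    refine Nat.Coprime.coprime_dvd_left hord (Nat.Coprime.symm ?_)
    rw [Nat.Prime.coprime_iff_not_dvd (by norm_num)]
    intro hd
    have h1 := two_pow_mod_seven r
    have h2 : 1 ≤ 2 ^ r := Nat.one_le_two_pow
    have h3 : r % 3 = 1 ∨ r % 3 = 2 := by omega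
    rcases h3 with h3 | h3 <;> rw [h3] at h1 <;> norm_num at h1 <;> omega
  obtain ⟨e, he⟩ := exists_pow_eq_self_of_coprime hcop.symm
  exact ⟨l ^ e, by rw [← pow_mul, mul_comm, pow_mul, he]⟩

/-- If `r ≡ s (mod 3)`, then `x ^ 2 ^ r / x ^ 2 ^ s` is a seventh power. -/
lemma exists_two_pow_power_eq_seventh_power_mul {L : Type*} [Field L] {r s : ℕ}
    (h : r % 3 = s % 3) {x : L} (hx : x ≠ 0) :
    ∃ z : L, z ≠ 0 ∧ x ^ 2 ^ r = z ^ 7 * x ^ 2 ^ s := by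
  have key : (2 ^ r : ℤ) - 2 ^ s ≡ 0 [ZMOD 7] := by
    have h1 : (2 ^ r) % 7 = (2 ^ s) % 7 := by
      rw [two_pow_mod_seven r, two_pow_mod_seven s, h]
    have h2 : ((2 ^ r : ℕ) : ℤ) % 7 = ((2 ^ s : ℕ) : ℤ) % 7 := by exact_mod_cast h1
    push_cast at h2
    exact Int.emod_eq_emod_iff_emod_sub_eq_zero.mp h2
  obtain ⟨e, he⟩ := (Int.modEq_zero_iff_dvd).mp key
  refine ⟨x ^ e, zpow_ne_zero _ hx, ?_⟩
  have h3 : (2 ^ r : ℤ) = e * 7 + 2 ^ s := by linarith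
  have h4 : x ^ ((2 ^ r : ℕ) : ℤ) = x ^ (e * 7 + ((2 ^ s : ℕ) : ℤ)) := by
    push_cast; rw [h3]
  rw [zpow_add₀ hx, zpow_mul, zpow_natCast, zpow_natCast] at h4
  exact_mod_cast h4

/-- If `gcd(s, n) = 1`, the only elements of a field with `2 ^ n` elements fixed by
`x ↦ x ^ 2 ^ s` are `0` and `1`. -/
lemma eq_zero_or_one_of_pow_two_pow_eq_self {L : Type*} [Field L] [Fintype L] {n s : ℕ}
    (hcard : Fintype.card L = 2 ^ n) (hgcd : Nat.gcd s n = 1) {y : L} (h : y ^ 2 ^ s = y) :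
    y = 0 ∨ y = 1 := by
  have hiter : ∀ r, (fun x : L => x ^ 2)^[r] y = y ^ 2 ^ r := fun r => by
    rw [pow_iterate]
  have hs : Function.IsPeriodicPt (fun x : L => x ^ 2) s y := (hiter s).trans h
  have hn : Function.IsPeriodicPt (fun x : L => x ^ 2) n y :=
    (hiter n).trans (by rw [← hcard, FiniteField.pow_card])
  have h1 := hs.gcd hn
  rw [hgcd] at h1
  have h2 : y ^ 2 = y := h1
  have h3 : y * (y - 1) = 0 := by linear_combination h2
  rcases mul_eq_zero.mp h3 with h4 | h4
  · exact Or.inl h4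
  · exact Or.inr (sub_eq_zero.mp h4)


/-- Let `f(x) = x^{2^s+1} + α x^{2^{ik} + 2^{mk+s}}` be the binomial of Family (1) on
`L = GF(2^{3k})` with `k` odd (so `n = 3k` is odd).  Then `f` is almost perfect
nonlinear (APN): for every `a ∈ L^*` and `b ∈ L`, the equation
`f(x + a) + f(x) = b` has at most 2 solutions `x ∈ L`. -/
theorem stmt17 (k s : ℕ) (hk : 3 ≤ k) (hkodd : Odd k) (hk3 : Nat.gcd k 3 = 1)
    (hs : 0 < s) (hgcd : Nat.gcd s (3 * k) = 1)
    (i m : ℕ) (hi : i = 1 ∨ i = 2) (hisk : i % 3 = (s * k) % 3)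
    (hm : m = 1 ∨ m = 2) (hmi : (m + i) % 3 = 0)
    (L : Type*) [Field L] [Fintype L] (hcard : Fintype.card L = 2 ^ (3 * k))
    (t : L) (ht : ∀ y : L, y ≠ 0 → ∃ j : ℕ, y = t ^ j)
    (α : L) (hα : α = t ^ (2 ^ k - 1))
    (f : L → L) (hf : ∀ x, f x = x ^ (2 ^ s + 1) + α * x ^ (2 ^ (i * k) + 2 ^ (m * k + s))) :
    ∀ a : L, a ≠ 0 → ∀ b : L, {x : L | f (x + a) + f x = b}.ncard ≤ 2 := by
  intro a ha b
  have hexp3k : ∀ x : L, x ^ 2 ^ (3 * k) = x := fun x => by rw [← hcard, FiniteField.pow_card]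
  have : CharP L 2 := by
    have : Fact (Nat.Prime 2) := ⟨Nat.prime_two⟩
    exact charP_of_card_eq_prime_pow hcard
  have hk3' : k % 3 ≠ 0 := fun h0 => by
    have := Nat.dvd_gcd (Nat.dvd_of_mod_eq_zero h0) (dvd_refl 3)
    rw [hk3] at this
    norm_num at this
  have hik3 : (i * k) % 3 ≠ 0 := by rcases hi with rfl | rfl <;> omega
  have hsi : s % 3 = (i * k) % 3 := by
    have h1 : (i * k) % 3 = ((s * k) % 3 * k) % 3 := by
      rw [← hisk, Nat.mul_mod i k 3, Nat.mul_mod (i % 3) k 3, Nat.mod_mod]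
    rw [h1]
    have h2 : k % 3 = 1 ∨ k % 3 = 2 := by omega
    rcases h2 with h2 | h2 <;> rw [Nat.mul_mod (s * k % 3) k 3, Nat.mul_mod s k 3, h2] <;> omega
  obtain ⟨σ, hσ⟩ : ∃ σ : L →+* L, ∀ x, σ x = x ^ 2 ^ s :=
    ⟨iterateFrobenius L 2 s, fun x => iterateFrobenius_def 2 s x⟩
  obtain ⟨τ, hτ⟩ : ∃ τ : L →+* L, ∀ x, τ x = x ^ 2 ^ (i * k) :=
    ⟨iterateFrobenius L 2 (i * k), fun x => iterateFrobenius_def 2 (i * k) x⟩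
  have hcomm : ∀ x, τ (σ x) = σ (τ x) := fun x => by
    rw [hτ, hσ, hσ, hτ, ← pow_mul, ← pow_mul, mul_comm]
  have hττ : ∀ x, τ (τ x) = x ^ 2 ^ (m * k) := fun x => by
    rw [hτ, hτ, ← pow_mul, ← pow_add]
    rcases hi with rfl | rfl <;> rcases hm with rfl | rfl <;> norm_num at hmi
    · congr 2; ring
    · rw [show 2 * k + 2 * k = 3 * k + 1 * k by ring, pow_add, pow_mul, hexp3k]
  have hτ3 : ∀ x, τ (τ (τ x)) = x := fun x => by
    rw [hττ, hτ, ← pow_mul, ← pow_add]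
    rcases hi with rfl | rfl <;> rcases hm with rfl | rfl <;> norm_num at hmi
    · rw [show 1 * k + 2 * k = 3 * k by ring, hexp3k]
    · rw [show 2 * k + 1 * k = 3 * k by ring, hexp3k]
  have hf' : ∀ x, f x = x * σ x + α * (τ x * σ (τ (τ x))) := fun x => by
    rw [hf, hττ, hσ, hσ, hτ]; ring
  have hdvd : 7 ∣ Fintype.card L - 1 := by
    have h1 := two_pow_mod_seven (3 * k)
    simp only [Nat.mul_mod_right] at h1
    have h2 : 1 ≤ 2 ^ (3 * k) := Nat.one_le_two_pow
    rw [hcard]; norm_num at h1; omega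
  have ht7 := generator_not_seventh_power hdvd t ht
  have ht0 : t ≠ 0 := fun h0 => ht7 0 (by rw [h0]; norm_num)
  have hαt : α * t = t ^ 2 ^ k := by
    rw [hα, ← pow_succ, Nat.sub_add_cancel Nat.one_le_two_pow]
  obtain ⟨w₁, hw₁, hαw, hw₁7⟩ : ∃ w₁ : L, w₁ ≠ 0 ∧ α * w₁ = τ (τ w₁) ∧ ∀ z, w₁ ≠ z ^ 7 := by
    rcases hi with rfl | rfl
    · refine ⟨(τ t)⁻¹, inv_ne_zero ((map_ne_zero τ).mpr ht0), ?_, fun z hz => ?_⟩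
      · rw [map_inv₀, map_inv₀, hτ3, ← div_eq_mul_inv, div_eq_iff ((map_ne_zero τ).mpr ht0), hτ,
          one_mul, ← hαt]
        field_simp
      · apply ht7 (τ (τ z⁻¹))
        rw [← map_pow, ← map_pow, inv_pow, ← hz, inv_inv, hτ3]
    · refine ⟨t, ht0, ?_, ht7⟩
      rw [hαt, hττ]
      rcases hm with rfl | rfl <;> norm_num at hmi
      rw [one_mul]
  have hτa : τ a ≠ 0 := (map_ne_zero τ).mpr ha
  have hσa : σ a ≠ 0 := (map_ne_zero σ).mpr ha
  have hquot : ∀ x : L, x ≠ 0 → ∃ z : L, z ≠ 0 ∧ σ x = z ^ 7 * τ x := fun x hx => by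
    rw [hσ, hτ]; exact exists_two_pow_power_eq_seventh_power_mul hsi hx
  obtain ⟨za, hza, hza7⟩ := hquot a ha
  have hw7 : ∀ z, za ^ 7 * w₁ ≠ z ^ 7 := fun z hz => by
    apply hw₁7 (z / za)
    rw [div_pow, ← hz]
    field_simp
  have hw0 : za ^ 7 * w₁ ≠ 0 := mul_ne_zero (pow_ne_zero _ hza) hw₁
  have hfixτ : ∀ l : L, l ≠ 0 → τ l = l → ∃ z : L, l = z ^ 7 := fun l hl h =>
    seventh_power_of_pow_two_pow_eq_self hik3 hl (by rw [← hτ, h])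
  have hkernel : ∀ y : L, a * σ a * (σ y - y) = α * τ a * σ (τ (τ a)) * (σ (τ (τ y)) - τ y) →
      y = 0 ∨ y = 1 := by
    intro y hy
    have hττza := congrArg (fun x => τ (τ x)) hza7
    simp only [map_mul, hcomm, hτ3] at hττza
    have hweq : za ^ 7 * w₁ * (σ y - y)
        = τ (τ (za ^ 7 * w₁)) * (σ (τ (τ y)) - τ y) := by
      refine mul_left_cancel₀ (mul_ne_zero ha hτa) ?_
      simp only [map_mul, ← hαw]
      rw [hza7, hττza] at hy
      linear_combination w₁ * hy
    have hw_fix : τ (za ^ 7 * w₁) ≠ za ^ 7 * w₁ := fun h => by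
      obtain ⟨z, hz⟩ := hfixτ _ hw0 h
      exact hw7 z hz
    rcases fixed_or_exists_twisted_quotient σ τ hcomm hτ3 _ y hw0 hweq with h | h | h
    · rw [h, h] at hweq
      have h1 : (za ^ 7 * w₁ - τ (τ (za ^ 7 * w₁))) * (σ y - y) = 0 := by
        linear_combination hweq
      rcases mul_eq_zero.mp h1 with h2 | h2
      · exact absurd (by
          have h3 := congrArg τ (sub_eq_zero.mp h2)
          rwa [hτ3] at h3) hw_fix
      · exact eq_zero_or_one_of_pow_two_pow_eq_self hcard hgcd
          (by rw [← hσ]; exact sub_eq_zero.mp h2)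
    · exact absurd h hw_fix
    · obtain ⟨d, l, hd, hl, hτl, hdl⟩ := h
      obtain ⟨zd, hzd, hzd7⟩ := hquot d hd
      obtain ⟨zl, hzl⟩ := hfixτ l hl hτl
      have hzl0 : zl ≠ 0 := fun h0 => hl (by rw [hzl, h0]; norm_num)
      refine absurd ?_ (hw7 (zd / zl))
      rw [hzd7, hzl] at hdl
      have h1 := mul_right_cancel₀ ((map_ne_zero τ).mpr hd) hdl
      rw [div_pow, h1]
      field_simp
  have hdiff : ∀ x x₀ : L, f (x + a) + f x = b → f (x₀ + a) + f x₀ = b →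
      x = x₀ ∨ x = x₀ + a := by
    intro x x₀ hx hx₀
    obtain ⟨y, rfl⟩ : ∃ y, x = x₀ + a * y := ⟨(x - x₀) / a, by field_simp; ring⟩
    have h2 : (2 : L) = 0 := CharTwo.two_eq_zero
    rw [← CharTwo.sub_eq_add] at hx hx₀
    simp only [hf', map_add, map_mul] at hx hx₀
    have := hkernel y (by
      linear_combination hx - hx₀ - (a * σ a * y + α * τ a * σ (τ (τ a)) * σ (τ (τ y))) * h2)
    rcases this with rfl | rfl
    · left; ring
    · right; ring
  rcases Set.eq_empty_or_nonempty {x : L | f (x + a) + f x = b} with h | ⟨x₀, hx₀⟩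
  · rw [h]; simp
  · refine (Set.ncard_le_ncard (t := {x₀, x₀ + a}) (fun x hx => ?_) (Set.toFinite _)).trans
      ((Set.ncard_insert_le _ _).trans (by rw [Set.ncard_singleton]))
    simpa using hdiff x x₀ hx hx₀
end

section
/- Let f be the binomial of Family (1) on L = GF(2^{3k}) with k odd (so that n = 3k is odd). Then the nonlinearity of f equals 2^{n−1} − 2^{(n−1)/2}; that is, max over a ∈ L, b ∈ L* of |f^W(a,b)| equals 2^{(n+1)/2}. -/
/-- The exponential sum of an additive map to `ZMod 2` is the group order or zero. -/
lemma sum_neg_one_pow_addHom {V : Type*} [AddCommGroup V] [Fintype V] (φ : V →+ ZMod 2) :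
    (φ = 0 → ∑ x, (-1 : ℤ) ^ (φ x).val = Fintype.card V) ∧
    (φ ≠ 0 → ∑ x, (-1 : ℤ) ^ (φ x).val = 0) := by
  refine ⟨fun h => by simp [h], fun h => ?_⟩
  obtain ⟨v, hv⟩ : ∃ v, φ v ≠ 0 := by
    by_contra! hc
    exact h (AddMonoidHom.ext hc)
  have hv1 : φ v = 1 := by
    generalize φ v = z at hv
    revert hv; revert z; decide
  have key : ∀ z : ZMod 2, (-1 : ℤ) ^ (z + 1).val = -(-1 : ℤ) ^ z.val := by decide
  have h1 : ∑ x, (-1 : ℤ) ^ (φ x).val = ∑ x, (-1 : ℤ) ^ (φ (x + v)).val :=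
    (Equiv.sum_comp (Equiv.addRight v) (fun x => (-1 : ℤ) ^ (φ x).val)).symm
  simp only [map_add, hv1, key, Finset.sum_neg_distrib] at h1
  omega

/-- The squared exponential sum of a quadratic function whose radical has at most two elements,
on a group of order an odd power of two. -/
lemma quadratic_sum_sq {V : Type*} [AddCommGroup V] [Fintype V] {n : ℕ} (hn : Odd n)
    (hcard : Fintype.card V = 2 ^ n) (F : V → ZMod 2) (B : V → V →+ ZMod 2)
    (hF : ∀ x y, F (x + y) = F x + F y + B y x)
    (hB : ∀ y z, B y = 0 → B z = 0 → y ≠ 0 → z ≠ 0 → y = z) :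
    (∑ x, (-1 : ℤ) ^ (F x).val) ^ 2 = 0 ∨ (∑ x, (-1 : ℤ) ^ (F x).val) ^ 2 = 2 ^ (n + 1) := by
  classical
  have hmul : ∀ a b : ZMod 2, (-1 : ℤ) ^ a.val * (-1 : ℤ) ^ (a + b).val = (-1 : ℤ) ^ b.val := by
    decide
  have hadd : ∀ a b : ZMod 2, (-1 : ℤ) ^ (a + b).val = (-1 : ℤ) ^ a.val * (-1 : ℤ) ^ b.val := by
    decide
  set W := ∑ x, (-1 : ℤ) ^ (F x).val with hW
  have hF0 : F 0 = 0 := by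
    have h := hF 0 0
    rw [add_zero, map_zero, add_zero] at h
    simpa using h
  have hB0 : B 0 = 0 := by
    ext x
    have h := hF x 0
    rw [add_zero, hF0, add_zero] at h
    simpa using h
  have hsq : W ^ 2 = ∑ y, if B y = 0 then (2 : ℤ) ^ n * (-1) ^ (F y).val else 0 := by
    calc W ^ 2 = ∑ x, ∑ y, (-1 : ℤ) ^ (F x).val * (-1 : ℤ) ^ (F (x + y)).val := by
          rw [sq, hW, Finset.sum_mul]
          refine Finset.sum_congr rfl fun x _ => ?_
          rw [Finset.mul_sum]
          exact (Equiv.sum_comp (Equiv.addLeft x)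
            (fun y => (-1 : ℤ) ^ (F x).val * (-1 : ℤ) ^ (F y).val)).symm
      _ = ∑ y, ∑ x, (-1 : ℤ) ^ (F y).val * (-1 : ℤ) ^ (B y x).val := by
          rw [Finset.sum_comm]
          refine Finset.sum_congr rfl fun y _ => Finset.sum_congr rfl fun x _ => ?_
          rw [hF, add_assoc, hmul, hadd]
      _ = _ := by
          refine Finset.sum_congr rfl fun y _ => ?_
          rw [← Finset.mul_sum]
          split_ifs with h
          · rw [(sum_neg_one_pow_addHom (B y)).1 h, hcard]
            push_cast
            ring
          · rw [(sum_neg_one_pow_addHom (B y)).2 h, mul_zero]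
  have hne : W ^ 2 ≠ 2 ^ n := by
    intro h
    have h2 : W.natAbs ^ 2 = 2 ^ n := by
      zify
      rw [sq_abs, h]
    obtain ⟨j, -, hj⟩ := (Nat.dvd_prime_pow Nat.prime_two).1 (Dvd.intro_left _ ((sq _).symm.trans h2))
    rw [hj, ← pow_mul] at h2
    have := Nat.pow_right_injective le_rfl h2
    obtain ⟨l, hl⟩ := hn
    omega
  by_cases hex : ∃ y, B y = 0 ∧ y ≠ 0
  · obtain ⟨y, hy, hy0⟩ := hex
    have h2 : W ^ 2 = 2 ^ n + 2 ^ n * (-1) ^ (F y).val := by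
      rw [hsq, ← Finset.sum_subset (Finset.subset_univ {0, y}), Finset.sum_pair hy0.symm]
      · simp [hB0, hF0, hy]
      · intro z _ hz
        simp only [Finset.mem_insert, Finset.mem_singleton, not_or] at hz
        rw [if_neg]
        intro h
        exact hz.2 (hB z y h hy hz.1 hy0)
    rcases neg_one_pow_eq_or ℤ (F y).val with h | h <;> rw [h] at h2
    · right; rw [h2]; ring
    · left; rw [h2]; ring
  · push Not at hex
    exfalso
    apply hne
    rw [hsq, ← Finset.sum_subset (Finset.subset_univ {0}), Finset.sum_singleton]
    · simp [hB0, hF0]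
    · intro z _ hz
      rw [if_neg fun h => hz (by simp [hex z h])]

/-- The radical equation, for commuting endomorphisms `θ` (of order three) and `τ`,
has at most one nonzero solution. -/
lemma radical_unique {L : Type*} [Field L] [CharP L 2] (θ τ : L →+* L)
    (hθ : ∀ x, θ (θ (θ x)) = x) (hc : ∀ x, τ (θ x) = θ (τ x))
    (χ : L →* L) (hχθ : ∀ y, y ≠ 0 → θ y = y → χ y = 1) (hχτ : ∀ y, χ (τ y) = χ y)
    (hfix : ∀ y, θ y = y → τ (τ y) = y → y = 0 ∨ y = 1)
    (g h : L) (hg : g ≠ 0) (hh : h ≠ 0) (hw : χ (h / g) ≠ 1)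
    (S : Set L) (hSadd : ∀ x ∈ S, ∀ y ∈ S, x + y ∈ S) (G : L →+ L)
    (hG1 : ∀ x ∈ S, g * G x = τ (h * (θ h * θ (θ x) + θ (θ h) * θ x)))
    (hG2 : ∀ x ∈ S, τ (h * G x) * (g * θ g * θ (θ g)) =
      τ (h * θ h * θ (θ h)) * (g * (θ g * θ (θ x) + θ (θ g) * θ x)))
    (x y : L) (hx : x ∈ S) (hy : y ∈ S) (hx0 : x ≠ 0) (hy0 : y ≠ 0) : x = y := by
  have h2 : (2 : L) = 0 := CharTwo.two_eq_zero
  have hinj : ∀ {z : L}, z ≠ 0 → θ z ≠ 0 := fun hz => (map_ne_zero θ).2 hz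
  have hinjτ : ∀ {z : L}, z ≠ 0 → τ z ≠ 0 := fun hz => (map_ne_zero τ).2 hz
  have hadd0 : ∀ {a b : L}, a + b = 0 → a = b := fun hab => CharTwo.add_eq_zero.1 hab
  -- the cross product of the conjugate vectors
  set c : L := θ g * θ (θ h) + θ (θ g) * θ h with hcdef
  have hg1 := hinj hg
  have hg2 := hinj hg1
  have hh1 := hinj hh
  have hh2 := hinj hh1
  have hc0 : c ≠ 0 := by
    intro hc'
    apply hw
    apply hχθ _ (div_ne_zero hh hg)
    have h3 := hadd0 hc'
    have h4 := congrArg θ (congrArg θ h3)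
    simp only [map_mul, hθ] at h4
    rw [map_div₀]
    field_simp
    linear_combination h4
  have hinj0 : ∀ z ∈ S, G z = 0 → z = 0 := by
    intro z hz hGz
    have e1 := hG1 z hz
    have e2 := hG2 z hz
    rw [hGz, mul_zero] at e1
    rw [hGz, mul_zero, map_zero, zero_mul] at e2
    have e3 : θ h * θ (θ z) + θ (θ h) * θ z = 0 :=
      (mul_eq_zero.1 ((map_eq_zero τ).1 e1.symm)).resolve_left hh
    have e4 : θ g * θ (θ z) + θ (θ g) * θ z = 0 := by
      refine (mul_eq_zero.1 ((mul_eq_zero.1 e2.symm).resolve_left ?_)).resolve_left hg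
      exact hinjτ (mul_ne_zero (mul_ne_zero hh hh1) hh2)
    have e5 : θ z * c = 0 := by
      rw [hcdef]
      linear_combination θ g * e3 + θ h * e4 - θ g * θ h * θ (θ z) * h2
    exact (map_eq_zero θ).1 ((mul_eq_zero.1 e5).resolve_right hc0)
  set D : L := g * c * τ (g / h) + θ (g * c * τ (g / h)) + θ (θ (g * c * τ (g / h))) with hD
  have hNτ : τ (h * θ h * θ (θ h)) ≠ 0 := hinjτ (mul_ne_zero (mul_ne_zero hh hh1) hh2)
  have hDN : D * τ (h * θ h * θ (θ h)) = g * c * τ (g * θ h * θ (θ h)) +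
      θ g * θ c * τ (h * θ g * θ (θ h)) + θ (θ g) * θ (θ c) * τ (h * θ h * θ (θ g)) := by
    have t1 := hinjτ hh
    have t2 := hinj t1
    have t3 := hinj t2
    rw [hD]
    simp only [map_div₀, map_mul, hc]
    field_simp
  have hD0 : D ≠ 0 := by
    intro hD'
    set μ : L := g * c * τ (θ h * θ (θ h)) / τ c with hμ
    have hτc := hinjτ hc0
    have hμ0 : μ ≠ 0 := div_ne_zero (mul_ne_zero (mul_ne_zero hg hc0)
      (hinjτ (mul_ne_zero hh1 hh2))) hτc
    have hμθ : θ μ = μ := by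
      rw [hμ, map_div₀, div_eq_div_iff (hinj hτc) hτc]
      rw [hD', zero_mul] at hDN
      simp only [hcdef, map_mul, map_add, hθ, hc] at hDN ⊢
      linear_combination -θ (θ (τ h)) * hDN +
        ((g * θ g * θ (θ h) + g * θ (θ g) * θ h + θ g * θ (θ g) * h -
          θ (θ g) * (g * θ h + θ g * h)) * (θ (θ (τ h)) * τ h * θ (τ h) * θ (θ (τ g))) -
        g * (θ g * θ (θ h) + θ (θ g) * θ h) * θ (τ h) * θ (θ (τ h)) *
          (θ (θ (τ g)) * τ h + τ g * θ (θ (τ h)))) * h2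
    have hχμ := hχθ μ hμ0 hμθ
    have hχN := hχθ (h * (θ h * θ (θ h))) (mul_ne_zero hh (mul_ne_zero hh1 hh2))
      (by simp only [map_mul, hθ]; ring)
    have hχc : χ c ≠ 0 := (hc0.isUnit.map χ).ne_zero
    have e1 : μ * τ c = g * c * τ (θ h * θ (θ h)) := div_mul_cancel₀ _ hτc
    have e2 := congrArg χ e1
    rw [map_mul, hχμ, hχτ, map_mul, hχτ, map_mul, one_mul] at e2
    have e3 : χ g * χ (θ h * θ (θ h)) = 1 := by
      apply mul_right_cancel₀ hχc
      linear_combination -e2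
    rw [map_mul] at hχN
    apply hw
    have e4 : h / g * g = h := div_mul_cancel₀ _ hg
    have e5 := congrArg χ e4
    rw [map_mul] at e5
    have e6 : χ g ≠ 0 := (hg.isUnit.map χ).ne_zero
    apply mul_right_cancel₀ e6
    linear_combination e5 - χ h * e3 + χ g * hχN
  have hlam : ∀ z ∈ S, θ (G z / c) = G z / c ∧ τ (τ (G z / c)) * τ D = G z / c * D := by
    intro z hz
    have e1 := hG1 z hz
    have e2 := hG2 z hz
    have e1' := congrArg θ e1
    have e1'' := congrArg θ e1'
    have e2' := congrArg θ e2
    have e2'' := congrArg θ e2'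
    have hN := mul_ne_zero (mul_ne_zero hg hg1) hg2
    have t1 : g * G z + θ g * θ (G z) + θ (θ g) * θ (θ (G z)) = 0 := by
      simp only [map_mul, map_add, hθ, hc] at e1 e1' e1''
      linear_combination e1 + e1' + e1'' + (τ h * θ (τ h) * θ (θ (τ z)) +
        τ h * θ (θ (τ h)) * θ (τ z) + θ (τ h) * θ (θ (τ h)) * τ z) * h2
    have t2 : h * G z + θ h * θ (G z) + θ (θ h) * θ (θ (G z)) = 0 := by
      refine (map_eq_zero τ).1 ((mul_eq_zero.1 ?_).resolve_right hN)
      simp only [map_mul, map_add, hθ, hc] at e2 e2' e2'' ⊢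
      linear_combination e2 + e2' + e2'' + τ h * θ (τ h) * θ (θ (τ h)) * (g * θ g * θ (θ z) +
        g * θ (θ g) * θ z + θ g * θ (θ g) * z) * h2
    have hlθ : θ (G z / c) = G z / c := by
      rw [map_div₀, div_eq_div_iff (hinj hc0) hc0, hcdef]
      simp only [map_mul, map_add, hθ]
      linear_combination -θ (θ h) * t1 - θ (θ g) * t2 + (θ (G z) * c + θ (θ h) * θ (θ g) * θ (θ (G z))) * h2
    refine ⟨hlθ, ?_⟩
    have hGl : G z = G z / c * c := (div_mul_cancel₀ _ hc0).symm
    set l := G z / c with hl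
    have hτh := hinjτ hh
    have f1 : τ (g * (θ h * θ (θ z) + θ (θ h) * θ z)) = l * (g * c * τ (g / h)) := by
      rw [map_div₀]
      field_simp
      rw [hGl, map_mul] at e1
      rw [map_mul]
      linear_combination -τ g * e1
    have f2 : h * (θ g * θ (θ z) + θ (θ g) * θ z) * τ (h * θ h * θ (θ h)) =
        τ l * (h * τ (h * c) * (θ g * θ (θ g))) := by
      apply mul_left_cancel₀ hg
      rw [hGl] at e2
      simp only [map_mul] at e2 ⊢
      linear_combination -h * e2
    set d : L := h * (θ g * θ (θ z) + θ (θ g) * θ z) + θ h * (θ (θ g) * z + g * θ (θ z)) +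
      θ (θ h) * (g * θ z + θ g * z) with hd
    have hd1 : τ d = l * D := by
      have f1' := congrArg θ f1
      have f1'' := congrArg θ f1'
      rw [map_mul θ l, hlθ] at f1' f1''
      rw [map_mul θ l, hlθ] at f1''
      rw [hD, mul_add, mul_add, ← f1'', ← f1', ← f1, hd]
      simp only [map_mul, map_add, hθ, hc]
      ring
    have hd2 : d = τ l * D := by
      apply mul_right_cancel₀ hNτ
      have hlτ : θ (τ l) = τ l := by rw [← hc, hlθ]
      have f2' := congrArg θ f2
      have f2'' := congrArg θ f2'
      rw [mul_assoc (τ l), hDN, hd]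
      rw [map_mul θ (τ l), hlτ] at f2' f2''
      rw [map_mul θ (τ l), hlτ] at f2''
      simp only [hcdef, map_mul, map_add, hθ, hc] at f2 f2' f2'' ⊢
      linear_combination f2 + f2' + f2''
    rw [← map_mul, ← hd2, hd1]
  have hGxy : G x / c = G y / c := by
    obtain ⟨a1, a2⟩ := hlam x hx
    obtain ⟨b1, b2⟩ := hlam y hy
    have hyc : G y / c ≠ 0 := div_ne_zero (fun h => hy0 (hinj0 y hy h)) hc0
    have hxc : G x / c ≠ 0 := div_ne_zero (fun h => hx0 (hinj0 x hx h)) hc0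
    rcases hfix ((G x / c) / (G y / c)) (by rw [map_div₀, a1, b1]) (by
      rw [map_div₀, map_div₀, div_eq_div_iff (hinjτ (hinjτ hyc)) hyc]
      apply mul_right_cancel₀ (mul_ne_zero hD0 (hinjτ hD0))
      linear_combination (G y / c * D) * a2 - (G x / c * D) * b2) with h | h
    · exact absurd h (div_ne_zero hxc hyc)
    · exact (div_eq_one_iff_eq hyc).1 h
  apply hadd0
  apply hinj0 _ (hSadd x hx y hy)
  rw [map_add, (div_left_inj' hc0).1 hGxy, CharTwo.add_self_eq_zero]

/-- The absolute trace to `GF(2)` is invariant under powers of the Frobenius map. -/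
lemma trace_iterateFrobenius {L : Type*} [Field L] [Fintype L] [Algebra (ZMod 2) L] [CharP L 2]
    (n : ℕ) (x : L) :
    Algebra.trace (ZMod 2) L (iterateFrobenius L 2 n x) = Algebra.trace (ZMod 2) L x := by
  induction n generalizing x with
  | zero => simp
  | succ n ih =>
    have h := Algebra.trace_eq_of_algEquiv
      (FiniteField.frobeniusAlgEquivOfAlgebraic (ZMod 2) L) (iterateFrobenius L 2 n x)
    rw [← ih x, ← h, FiniteField.coe_frobeniusAlgEquivOfAlgebraic, ZMod.card]
    rw [iterateFrobenius_def, iterateFrobenius_def, pow_succ 2 n, pow_mul]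

/-- An element of a finite field of characteristic two with zero trace functional is zero. -/
lemma eq_zero_of_trace_mul {L : Type*} [Field L] [Fintype L] [Algebra (ZMod 2) L] (u : L)
    (h : ∀ x, Algebra.trace (ZMod 2) L (u * x) = 0) : u = 0 :=
  (traceForm_nondegenerate (ZMod 2) L).1 u h

/-- An element fixed by two iterates of the Frobenius map with coprime exponents lies in `GF(2)`. -/
lemma eq_zero_or_one_of_coprime {L : Type*} [Field L] {a b : ℕ} (hab : Nat.gcd a b = 1) {y : L}
    (ha : y ^ 2 ^ a = y) (hb : y ^ 2 ^ b = y) : y = 0 ∨ y = 1 := by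
  have key : ∀ c, y ^ 2 ^ c = y → Function.IsPeriodicPt (fun z : L => z ^ 2) c y := by
    intro c hc
    rw [Function.IsPeriodicPt, Function.IsFixedPt, pow_iterate]
    exact hc
  have h := (key a ha).gcd (key b hb)
  rw [hab] at h
  have h1 : y ^ 2 = y := h
  have h3 : y * (y - 1) = 0 := by linear_combination h1
  exact (mul_eq_zero.1 h3).imp_right sub_eq_zero.1

/-- If `3` does not divide `k` then `2 ^ k` is `2` or `4` modulo `7`. -/
lemma two_pow_mod_seven_s18 {k : ℕ} (hk3 : Nat.gcd k 3 = 1) :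
    (2 ^ k % 7 = 2 ∨ 2 ^ k % 7 = 4) := by
  have h8 : ∀ q, 8 ^ q % 7 = 1 := fun q => by rw [Nat.pow_mod]; simp
  have hk : k % 3 ≠ 0 := by
    intro h
    rw [Nat.gcd_eq_right (Nat.dvd_of_mod_eq_zero h)] at hk3
    omega
  have h2 := Nat.div_add_mod k 3
  have h1 : 2 ^ k = 8 ^ (k / 3) * 2 ^ (k % 3) := by
    conv_lhs => rw [← h2, pow_add, pow_mul]
    norm_num
  rw [h1, Nat.mul_mod, h8]
  have : k % 3 = 1 ∨ k % 3 = 2 := by omega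
  rcases this with h | h <;> simp [h]

/-- The index of the subgroup of seventh powers in `GF(2^(3k))`, as an exponent. -/
lemma exists_seventh_exponent {k : ℕ} (hk : 0 < k) (hk3 : Nat.gcd k 3 = 1) :
    ∃ e, 0 < e ∧ 7 * e = 2 ^ (3 * k) - 1 ∧ (2 ^ k - 1) ∣ e := by
  have h7 : 7 ∣ (2 ^ k) ^ 2 + 2 ^ k + 1 := by
    apply Nat.dvd_of_mod_eq_zero
    rcases two_pow_mod_seven_s18 hk3 with h | h <;> simp [Nat.add_mod, Nat.pow_mod, h]
  obtain ⟨d, hd⟩ := h7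
  have h2 : 2 ≤ 2 ^ k := Nat.le_self_pow hk.ne' 2
  obtain ⟨p, hp⟩ : ∃ p, 2 ^ k = p + 1 := ⟨2 ^ k - 1, by omega⟩
  have hmul : 7 * (p * d) = 2 ^ (3 * k) - 1 := by
    rw [mul_comm 3 k, pow_mul, hp]
    rw [hp] at hd
    have : (p + 1) ^ 3 = 7 * (p * d) + 1 := by linear_combination p * hd
    omega
  refine ⟨p * d, ?_, hmul, by rw [hp]; exact ⟨d, rfl⟩⟩
  have : 0 < d := by
    rcases Nat.eq_zero_or_pos d with h | h
    · simp [h] at hd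
    · exact h
  exact Nat.mul_pos (by omega) this

/-- The squared Walsh coefficients of `x θτ(x) + α θ(x) τ(x)`, where `θ` and `τ` are the powers
of the Frobenius map with exponents `i k` and `2 i k + s`. -/
lemma walsh_sq (k s : ℕ) (hk : 3 ≤ k) (hkodd : Odd k) (hk3 : Nat.gcd k 3 = 1)
    (hgcd : Nat.gcd s (3 * k) = 1)
    (i : ℕ) (hi : i = 1 ∨ i = 2) (hisk : i % 3 = (s * k) % 3)
    (L : Type*) [Field L] [Fintype L] [Algebra (ZMod 2) L] [CharP L 2]
    (hcard : Fintype.card L = 2 ^ (3 * k))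
    (t : L) (ht : ∀ y : L, y ≠ 0 → ∃ j : ℕ, y = t ^ j)
    (α : L) (hα : α = t ^ (2 ^ k - 1)) (f : L → L) (θ τ : L →+* L)
    (hθdef : θ = iterateFrobenius L 2 (i * k)) (hτdef : τ = iterateFrobenius L 2 (2 * (i * k) + s))
    (hf : ∀ x, f x = x * θ (τ x) + α * (θ x * τ x)) (a b : L) (hb : b ≠ 0) :
    (∑ x : L, (-1 : ℤ) ^ (Algebra.trace (ZMod 2) L (a * x + b * f x)).val) ^ 2 = 0 ∨
    (∑ x : L, (-1 : ℤ) ^ (Algebra.trace (ZMod 2) L (a * x + b * f x)).val) ^ 2 =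
      2 ^ (3 * k + 1) := by
  have hper : ∀ (x : L) (q : ℕ), x ^ 2 ^ (3 * k * q) = x := by
    intro x q
    have := FiniteField.pow_card_pow q x
    rwa [hcard, ← pow_mul] at this
  have hθx : ∀ x, θ x = x ^ 2 ^ (i * k) := fun x => by rw [hθdef, iterateFrobenius_def]
  have hτx : ∀ x, τ x = x ^ 2 ^ (2 * (i * k) + s) := fun x => by rw [hτdef, iterateFrobenius_def]
  have hθ : ∀ x, θ (θ (θ x)) = x := by
    intro x
    rw [hθx, hθx, hθx, ← pow_mul, ← pow_mul, ← pow_add, ← pow_add]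
    convert hper x i using 3
    ring
  have hc : ∀ x, τ (θ x) = θ (τ x) := by
    intro x
    rw [hτx, hθx, hθx, hτx, ← pow_mul, ← pow_mul, mul_comm]
  have hTθ : ∀ x, Algebra.trace (ZMod 2) L (θ x) = Algebra.trace (ZMod 2) L x := fun x => by
    rw [hθdef, trace_iterateFrobenius]
  have hTτ : ∀ x, Algebra.trace (ZMod 2) L (τ x) = Algebra.trace (ZMod 2) L x := fun x => by
    rw [hτdef, trace_iterateFrobenius]
  have hτsurj : Function.Surjective τ := Finite.surjective_of_injective τ.injective
  have hθfix : ∀ y, θ y = y → y ^ 2 ^ k = y := by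
    intro y hy
    rcases hi with rfl | rfl
    · rw [hθx, one_mul] at hy
      exact hy
    · rw [hθx] at hy
      have h3 := hper y 1
      rw [show 3 * k * 1 = 2 * k + k by ring, pow_add, pow_mul, hy] at h3
      exact h3
  -- the character detecting seventh powers
  obtain ⟨e, he0, he7, hek⟩ := exists_seventh_exponent (by omega) hk3
  have he7' : ∀ y : L, y ≠ 0 → (y ^ e) ^ 7 = 1 := by
    intro y hy
    rw [← pow_mul, mul_comm, he7, ← hcard, FiniteField.pow_card_sub_one_eq_one y hy]
  have h3j : ∃ j, 2 * (i * k) + s = 3 * j := by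
    have hk' : k % 3 ≠ 0 := by
      intro h
      rw [Nat.gcd_eq_right (Nat.dvd_of_mod_eq_zero h)] at hk3
      omega
    have hkk : k % 3 = 1 ∨ k % 3 = 2 := by omega
    have hss : s % 3 = 0 ∨ s % 3 = 1 ∨ s % 3 = 2 := by omega
    apply Nat.dvd_of_mod_eq_zero
    rcases hi with rfl | rfl <;> rcases hkk with h | h <;> rcases hss with h' | h' | h' <;>
      simp [Nat.mul_mod, Nat.add_mod, h, h'] at hisk ⊢
  let χ : L →* L := powMonoidHom e
  have hχ : ∀ y, χ y = y ^ e := fun y => rfl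
  have hχθ : ∀ y, y ≠ 0 → θ y = y → χ y = 1 := by
    intro y hy hθy
    obtain ⟨d, hd⟩ := hek
    have h1 := hθfix y hθy
    have h2 : y ^ (2 ^ k - 1) = 1 := by
      apply mul_right_cancel₀ hy
      rw [← pow_succ, Nat.sub_add_cancel Nat.one_le_two_pow, h1, one_mul]
    rw [hχ, hd, pow_mul, h2, one_pow]
  have hχτ : ∀ y, χ (τ y) = χ y := by
    intro y
    rcases eq_or_ne y 0 with rfl | hy
    · rw [map_zero]
    obtain ⟨j, hj⟩ := h3j
    have h8 : ∀ j, (y ^ e) ^ 8 ^ j = y ^ e := by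
      intro j
      induction j with
      | zero => simp
      | succ j ih => rw [pow_succ, pow_mul, ih, pow_succ, he7' y hy, one_mul]
    rw [hχ, hχ, hτx, hj, pow_mul 2, pow_right_comm]
    exact h8 j
  have hfix : ∀ y, θ y = y → τ (τ y) = y → y = 0 ∨ y = 1 := by
    intro y h1 h2
    rw [hτx, hτx, ← pow_mul, ← pow_add] at h2
    refine eq_zero_or_one_of_coprime (a := k) ?_ (hθfix y h1) h2
    have hks : Nat.Coprime k s := (Nat.Coprime.coprime_mul_left_right hgcd).symm
    have hk2 : Nat.Coprime k 2 := hkodd.coprime_two_right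
    have : 2 * (i * k) + s + (2 * (i * k) + s) = 2 * s + k * (4 * i) := by ring
    rw [this]
    change Nat.Coprime _ _
    rw [Nat.coprime_add_mul_left_right]
    exact hk2.mul_right hks
  have hcardL : 2 < Fintype.card L := by
    rw [hcard]
    calc 2 < 2 ^ 2 := by norm_num
      _ ≤ 2 ^ (3 * k) := Nat.pow_le_pow_right (by norm_num) (by omega)
  have ht0 : t ≠ 0 := by
    rintro rfl
    obtain ⟨y, hy0, hy1⟩ : ∃ y : L, y ≠ 0 ∧ y ≠ 1 := by
      obtain ⟨y, hy⟩ := Fintype.exists_ne_of_one_lt_card (by omega : 1 < Fintype.card L) (0 : L)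
      classical
      obtain ⟨z, hz⟩ : ∃ z, z ∉ ({0, 1} : Finset L) := by
        by_contra! hcon
        have := Finset.card_le_card (fun z _ => hcon z : (Finset.univ : Finset L) ⊆ {0, 1})
        have h2 := Finset.card_le_two (a := (0 : L)) (b := 1)
        rw [Finset.card_univ] at this
        omega
      simp only [Finset.mem_insert, Finset.mem_singleton, not_or] at hz
      exact ⟨z, hz⟩
    obtain ⟨j, hj⟩ := ht y hy0
    rcases Nat.eq_zero_or_pos j with h | h
    · exact hy1 (by rw [hj, h, pow_zero])
    · exact hy0 (by rw [hj, zero_pow h.ne'])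
  have hχt : χ t ≠ 1 := by
    intro h
    have hord : orderOf (Units.mk0 t ht0) = Nat.card Lˣ := by
      apply orderOf_eq_card_of_forall_mem_zpowers
      intro x
      obtain ⟨j, hj⟩ := ht x x.ne_zero
      exact ⟨j, by ext; simp [hj]⟩
    have hdvd : orderOf (Units.mk0 t ht0) ∣ e := by
      apply orderOf_dvd_of_pow_eq_one
      ext
      simpa [hχ] using h
    rw [hord, Nat.card_units, Nat.card_eq_fintype_card, hcard, ← he7] at hdvd
    have := Nat.le_of_dvd he0 hdvd
    omega
  obtain ⟨w, hw0, hwα, hχw⟩ : ∃ w, w ≠ 0 ∧ α * w = θ w ∧ χ w ≠ 1 := by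
    have hαt : α * t = t ^ 2 ^ k := by
      rw [hα, ← pow_succ, Nat.sub_add_cancel Nat.one_le_two_pow]
    rcases hi with rfl | rfl
    · exact ⟨t, ht0, by rw [hθx, one_mul, hαt], hχt⟩
    · refine ⟨t * θ t, mul_ne_zero ht0 ((map_ne_zero θ).2 ht0), ?_, ?_⟩
      · have h4 : θ (θ t) = t ^ 2 ^ k := by
          rw [hθx, hθx, ← pow_mul, ← pow_add, show 2 * k + 2 * k = 3 * k * 1 + k by ring, pow_add,
            pow_mul, hper]
        rw [← mul_assoc, hαt, map_mul, h4, mul_comm]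
      · intro h
        apply hχt
        have h1 : χ t ^ (1 + (2 ^ k) ^ 2) = 1 := by
          rw [← h, map_mul, hθx, map_pow, pow_add, pow_one, mul_comm 2 k, pow_mul]
        have hd1 := orderOf_dvd_of_pow_eq_one h1
        have hd2 := orderOf_dvd_of_pow_eq_one (he7' t ht0)
        rcases (Nat.dvd_prime (by norm_num : Nat.Prime 7)).1 hd2 with h | h
        · exact orderOf_eq_one_iff.1 h
        · rw [← hχ] at h
          rw [h] at hd1
          have hm := Nat.mod_eq_zero_of_dvd hd1
          rcases two_pow_mod_seven_s18 hk3 with h' | h' <;>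
            simp [Nat.add_mod, Nat.pow_mod, h'] at hm
  set c := b * α with hcdef
  have hr0 : θ (b / w) ≠ 0 := (map_ne_zero θ).2 (div_ne_zero hb hw0)
  obtain ⟨h, hh⟩ := hτsurj (θ (b / w))
  have hh0 : h ≠ 0 := by
    rintro rfl
    exact hr0 (by rw [← hh, map_zero])
  set g := τ h / w with hg
  have hg0 : g ≠ 0 := div_ne_zero (by rwa [hh]) hw0
  have hgw : τ h = g * w := (div_mul_cancel₀ _ hw0).symm
  have hbr : b = θ (θ (τ h)) * w := by rw [hh, hθ, div_mul_cancel₀ _ hw0]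
  have hcr : c = θ (θ (τ h)) * θ w := by rw [hcdef, hbr, ← hwα]; ring
  have hχq : χ (h / g) ≠ 1 := by
    have : χ (h / g) = χ w := by
      have h1 := congrArg χ hgw
      have h2 := congrArg χ (div_mul_cancel₀ h hg0)
      rw [hχτ, map_mul] at h1
      rw [map_mul] at h2
      apply mul_right_cancel₀ (hg0.isUnit.map χ).ne_zero
      rw [h2, h1, mul_comm]
    rw [this]
    exact hχw
  let G : L →+ L := AddMonoidHom.mk' (fun z => b * θ (τ z) + θ (θ c) * θ (θ (τ z)))
    (fun x y => by simp only [map_add]; ring)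
  have hG : ∀ z, G z = b * θ (τ z) + θ (θ c) * θ (θ (τ z)) := fun z => rfl
  let S : Set L := {z | θ (τ (G z)) = b * z + θ c * θ (θ z)}
  have huniq := radical_unique θ τ hθ hc χ hχθ hχτ hfix g h hg0 hh0 hχq S
    (fun x hx y hy => by
      simp only [S, Set.mem_ofPred_eq, map_add] at hx hy ⊢
      rw [hx, hy]; ring) G
    (fun z _ => by
      rw [hG, hcr, hbr]
      simp only [map_mul, map_add, hθ, hc]
      linear_combination
        -(θ (θ (τ h)) * θ (τ z) + θ (τ h) * θ (θ (τ z))) * hgw)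
    (fun z hz => by
      have h1 := congrArg θ (congrArg θ (show θ (τ (G z)) = b * z + θ c * θ (θ z) from hz))
      rw [hθ] at h1
      have hgw' := congrArg θ hgw
      have hgw'' := congrArg θ hgw'
      rw [map_mul, h1, hcr, hbr]
      simp only [map_mul, map_add, hθ, hc] at hgw' hgw'' ⊢
      linear_combination
        -τ h * θ (τ h) * θ (θ z) * g * θ g * hgw'' - τ h * θ (θ (τ h)) * θ z * g * θ (θ g) * hgw')
  let B : L → L →+ ZMod 2 := fun y => AddMonoidHom.mk'
    (fun x => Algebra.trace (ZMod 2) L (b * (x * θ (τ y) + y * θ (τ x)) +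
      c * (θ x * τ y + θ y * τ x)))
    (fun x x' => by rw [← map_add]; congr 1; simp only [map_add]; ring)
  have hBS : ∀ y, B y = 0 → y ∈ S := by
    intro y hy
    have h0 : θ (τ (G y)) + (b * y + θ c * θ (θ y)) = 0 := by
      apply eq_zero_of_trace_mul
      intro v
      obtain ⟨x', rfl⟩ := Finite.surjective_of_injective θ.injective v
      obtain ⟨x, rfl⟩ := hτsurj x'
      have h1 : Algebra.trace (ZMod 2) L (b * (x * θ (τ y) + y * θ (τ x)) +
        c * (θ x * τ y + θ y * τ x)) = 0 := DFunLike.congr_fun hy x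
      rw [← h1]
      have e1 := hTτ (G y * x)
      rw [← hTθ] at e1
      have e2 := hTθ (c * (θ y * τ x))
      have e3 := (hTθ (θ (c * (θ x * τ y)))).trans (hTθ _)
      rw [add_mul, map_add, ← map_mul, ← map_mul, e1, hG]
      simp only [mul_add, add_mul, map_add]
      rw [← e2, ← e3]
      simp only [map_mul, hθ]
      ring_nf
    exact CharTwo.add_eq_zero.1 h0
  have hnodd : Odd (3 * k) := Odd.mul (by decide) hkodd
  refine quadratic_sum_sq hnodd hcard (fun x => Algebra.trace (ZMod 2) L (a * x + b * f x)) B ?_ ?_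
  · intro x y
    change _ = _ + _ + Algebra.trace (ZMod 2) L _
    rw [← map_add, ← map_add]
    congr 1
    simp only [hf, map_add, hcdef]
    ring
  · intro y z hy hz hy0 hz0
    exact huniq y z (hBS y hy) (hBS z hz) hy0 hz0


/-- Let `f(x) = x^{2^s+1} + α x^{2^{ik} + 2^{mk+s}}` be the binomial of Family (1) on
`L = GF(2^{3k})` with `k` odd (so `n = 3k` is odd).  Then the nonlinearity of `f`
equals `2^{n-1} - 2^{(n-1)/2}`; that is, the maximum over `a ∈ L`, `b ∈ L^*` of
`|f^W(a,b)|` equals `2^{(n+1)/2}`. -/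
theorem stmt18 (k s : ℕ) (hk : 3 ≤ k) (hkodd : Odd k) (hk3 : Nat.gcd k 3 = 1)
    (hs : 0 < s) (hgcd : Nat.gcd s (3 * k) = 1)
    (i m : ℕ) (hi : i = 1 ∨ i = 2) (hisk : i % 3 = (s * k) % 3)
    (hm : m = 1 ∨ m = 2) (hmi : (m + i) % 3 = 0)
    (L : Type*) [Field L] [Fintype L] [Algebra (ZMod 2) L]
    (hcard : Fintype.card L = 2 ^ (3 * k))
    (t : L) (ht : ∀ y : L, y ≠ 0 → ∃ j : ℕ, y = t ^ j)
    (α : L) (hα : α = t ^ (2 ^ k - 1))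
    (f : L → L) (hf : ∀ x, f x = x ^ (2 ^ s + 1) + α * x ^ (2 ^ (i * k) + 2 ^ (m * k + s))) :
    IsGreatest {w : ℤ | ∃ a b : L, b ≠ 0 ∧
        w = |∑ x : L, (-1 : ℤ) ^ (Algebra.trace (ZMod 2) L (a * x + b * f x)).val|}
      (2 ^ ((3 * k + 1) / 2)) := by
  have : CharP L 2 := charP_of_injective_algebraMap (algebraMap (ZMod 2) L).injective 2
  have hper : ∀ (x : L) (q : ℕ), x ^ 2 ^ (3 * k * q) = x := by
    intro x q
    have := FiniteField.pow_card_pow q x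
    rwa [hcard, ← pow_mul] at this
  have hf' : ∀ x, f x = x * iterateFrobenius L 2 (i * k) (iterateFrobenius L 2 (2 * (i * k) + s) x)
      + α * (iterateFrobenius L 2 (i * k) x * iterateFrobenius L 2 (2 * (i * k) + s) x) := by
    intro x
    have h1 : (x ^ 2 ^ (2 * (i * k) + s)) ^ 2 ^ (i * k) = x ^ 2 ^ s := by
      rw [← pow_mul, ← pow_add, show 2 * (i * k) + s + i * k = 3 * k * i + s by ring, pow_add,
        pow_mul, hper]
    have h2 : x ^ 2 ^ (2 * (i * k) + s) = x ^ 2 ^ (m * k + s) := by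
      rcases hi with rfl | rfl <;> rcases hm with rfl | rfl <;> try omega
      · simp
      · rw [show 2 * (2 * k) + s = 3 * k * 1 + (1 * k + s) by ring, pow_add, pow_mul, hper]
    rw [hf]
    simp only [iterateFrobenius_def]
    rw [h1, h2]
    ring
  have hsq := walsh_sq k s hk hkodd hk3 hgcd i hi hisk L hcard t ht α hα f _ _ rfl rfl hf'
  have habs : ∀ W : ℤ, W ^ 2 = 2 ^ (3 * k + 1) → |W| = 2 ^ ((3 * k + 1) / 2) := by
    intro W hW
    have h2 : (3 * k + 1) / 2 * 2 = 3 * k + 1 := by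
      obtain ⟨l, rfl⟩ := hkodd
      omega
    rw [← h2, pow_mul, sq_eq_sq_iff_abs_eq_abs] at hW
    rw [hW, abs_of_nonneg (by positivity)]
  constructor
  · obtain ⟨a, ha⟩ : ∃ a : L,
        ∑ x : L, (-1 : ℤ) ^ (Algebra.trace (ZMod 2) L (a * x + 1 * f x)).val ≠ 0 := by
      by_contra! hcon
      have hmul : ∀ u v : ZMod 2, (-1 : ℤ) ^ (u + v).val = (-1 : ℤ) ^ u.val * (-1 : ℤ) ^ v.val := by
        decide
      have h0 : ∑ a : L, ∑ x : L,
          (-1 : ℤ) ^ (Algebra.trace (ZMod 2) L (a * x + 1 * f x)).val = 0 :=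
        Finset.sum_eq_zero fun a _ => hcon a
      rw [Finset.sum_comm, Finset.sum_eq_single 0] at h0
      · simp [hf] at h0
      · intro x _ hx
        simp only [map_add, hmul]
        rw [← Finset.sum_mul]
        have hne : (Algebra.trace (ZMod 2) L).toAddMonoidHom.comp (AddMonoidHom.mulRight x) ≠ 0 := by
          intro h
          refine hx (eq_zero_of_trace_mul x fun y => ?_)
          rw [mul_comm]
          exact DFunLike.congr_fun h y
        have h1 := (sum_neg_one_pow_addHom _).2 hne
        simp only [AddMonoidHom.coe_comp, Function.comp_apply, AddMonoidHom.coe_mulRight,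
          LinearMap.toAddMonoidHom_coe] at h1
        rw [h1, zero_mul]
      · simp
    refine ⟨a, 1, one_ne_zero, (habs _ ?_).symm⟩
    exact (hsq a 1 one_ne_zero).resolve_left (pow_ne_zero 2 ha)
  · rintro _ ⟨a, b, hb, rfl⟩
    rcases hsq a b hb with h | h
    · rw [pow_eq_zero_iff two_ne_zero] at h
      rw [h, abs_zero]
      positivity
    · exact (habs _ h).le
end
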